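/- Consider the AUC kernel h(x,z) = 𝟙{z < x} with X and Z as specified and with p = 1 − q = ε for ε ∈ (0,1). Then U(h) = 1 − ε², the ratio of the pairwise to the single-sample variance components satisfies σ_0²/(σ_1² + σ_2²) = (1 − ε)/(2ε), and this ratio tends to +∞ as ε → 0⁺. -/

import Mathlib

open MeasureTheory ProbabilityTheory Filter
open scoped ENNReal

noncomputable section

/-- The AUC kernel `h(x,z) = 𝟙{z < x}`. -/
def aucH (x z : ℝ) : ℝ := if z < x then 1 else 0

/-- `h₁(x) = E[h(x, Z)]`. -/
def aucH1 {Ω : Type} [MeasurableSpace Ω] (μ : Measure Ω) (Z : Ω → ℝ) (x : ℝ) : ℝ :=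
  ∫ ω, aucH x (Z ω) ∂μ

/-- `h₂(z) = E[h(X, z)]`. -/
def aucH2 {Ω : Type} [MeasurableSpace Ω] (μ : Measure Ω) (X : Ω → ℝ) (z : ℝ) : ℝ :=
  ∫ ω, aucH (X ω) z ∂μ

/-- `U(h) = E[h(X, Z)]`. -/
def aucU {Ω : Type} [MeasurableSpace Ω] (μ : Measure Ω) (X Z : Ω → ℝ) : ℝ :=
  ∫ ω, aucH (X ω) (Z ω) ∂μ

/-- Hoeffding remainder `h₀(x,z) = h(x,z) − h₁(x) − h₂(z) + U(h)`. -/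
def aucH0 {Ω : Type} [MeasurableSpace Ω] (μ : Measure Ω) (X Z : Ω → ℝ) (x z : ℝ) : ℝ :=
  aucH x z - aucH1 μ Z x - aucH2 μ X z + aucU μ X Z

section BinaryPair

variable {Ω : Type} [MeasurableSpace Ω] {μ : Measure Ω} [IsProbabilityMeasure μ] {A B : Ω → ℝ}

lemma integrable_of_zero_or_one (hA : Measurable A) (hA01 : ∀ ω, A ω = 0 ∨ A ω = 1) :
    Integrable A μ := by
  refine Integrable.of_bound hA.aestronglyMeasurable 1 (Eventually.of_forall fun ω => ?_)
  rcases hA01 ω with h | h <;> simp [h]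

/-- The mean of a multilinear polynomial in two independent `{0, 1}`-valued variables. -/
lemma integral_multilinear_of_indepFun (hA : Measurable A) (hB : Measurable B)
    (hA01 : ∀ ω, A ω = 0 ∨ A ω = 1) (hB01 : ∀ ω, B ω = 0 ∨ B ω = 1)
    (hAB : IndepFun A B μ) (a b c d : ℝ) :
    ∫ ω, (a + b * A ω + c * B ω + d * (A ω * B ω)) ∂μ
      = a + b * (∫ ω, A ω ∂μ) + c * (∫ ω, B ω ∂μ)
        + d * ((∫ ω, A ω ∂μ) * ∫ ω, B ω ∂μ) := by
  have iA : Integrable A μ := integrable_of_zero_or_one hA hA01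
  have iB : Integrable B μ := integrable_of_zero_or_one hB hB01
  have iAB : Integrable (fun ω => A ω * B ω) μ := by
    refine integrable_of_zero_or_one (hA.mul hB) fun ω => ?_
    rcases hA01 ω with h | h <;> rcases hB01 ω with h' | h' <;> simp [h, h']
  have hprod : ∫ ω, A ω * B ω ∂μ = (∫ ω, A ω ∂μ) * ∫ ω, B ω ∂μ :=
    hAB.integral_fun_mul_eq_mul_integral hA.aestronglyMeasurable hB.aestronglyMeasurable
  have i₁ : Integrable (fun ω => a + b * A ω) μ := (integrable_const a).add (iA.const_mul b)
  have i₂ : Integrable (fun ω => a + b * A ω + c * B ω) μ := i₁.add (iB.const_mul c)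
  rw [integral_add i₂ (iAB.const_mul d), integral_add i₁ (iB.const_mul c),
    integral_add (integrable_const a) (iA.const_mul b),
    integral_const_mul, integral_const_mul, integral_const_mul, hprod]
  simp

/-- The variance of a multilinear polynomial in two independent `{0, 1}`-valued variables with
common mean `ε`. -/
lemma variance_multilinear_of_indepFun (hA : Measurable A) (hB : Measurable B)
    (hA01 : ∀ ω, A ω = 0 ∨ A ω = 1) (hB01 : ∀ ω, B ω = 0 ∨ B ω = 1)
    (hAB : IndepFun A B μ) {ε : ℝ} (hAε : ∫ ω, A ω ∂μ = ε) (hBε : ∫ ω, B ω ∂μ = ε)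
    (a b c d : ℝ) :
    variance (fun ω => a + b * A ω + c * B ω + d * (A ω * B ω)) μ
      = ((b + d * ε) ^ 2 + (c + d * ε) ^ 2) * (ε * (1 - ε)) + d ^ 2 * (ε * (1 - ε)) ^ 2 := by
  rw [variance_eq_integral (by fun_prop),
    integral_multilinear_of_indepFun hA hB hA01 hB01 hAB, hAε, hBε]
  set m := b * ε + c * ε + d * (ε * ε) with hm
  have hsq : ∀ ω, (a + b * A ω + c * B ω + d * (A ω * B ω)
        - (a + b * ε + c * ε + d * (ε * ε))) ^ 2
      = m ^ 2 + (b ^ 2 - 2 * m * b) * A ω + (c ^ 2 - 2 * m * c) * B ω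
        + (2 * b * c + 2 * b * d + 2 * c * d + d ^ 2 - 2 * m * d) * (A ω * B ω) := by
    intro ω
    rcases hA01 ω with h | h <;> rcases hB01 ω with h' | h' <;> rw [h, h', hm] <;> ring
  simp_rw [hsq]
  rw [integral_multilinear_of_indepFun hA hB hA01 hB01 hAB, hAε, hBε, hm]
  ring

end BinaryPair

/-- For the AUC kernel with `p = 1 − q = ε`: `U(h) = 1 − ε²`, the ratio of the pairwise
to the single-sample variance components equals `(1−ε)/(2ε)`, and this ratio tends to
`+∞` as `ε → 0⁺`. -/
theorem auc_pairwise_variance_ratio (ε : ℝ) (hε : ε ∈ Set.Ioo (0 : ℝ) 1)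
    {Ω : Type} [MeasurableSpace Ω] (μ : Measure Ω) [IsProbabilityMeasure μ]
    (X Z : Ω → ℝ) (hXmeas : Measurable X) (hZmeas : Measurable Z)
    (hXval : ∀ ω, X ω = 0 ∨ X ω = 2) (hZval : ∀ ω, Z ω = -1 ∨ Z ω = 1)
    (hX2 : μ {ω | X ω = 2} = ENNReal.ofReal (1 - ε))
    (hZ1 : μ {ω | Z ω = 1} = ENNReal.ofReal ε)
    (hXZ : IndepFun X Z μ) :
    aucU μ X Z = 1 - ε ^ 2 ∧
    variance (fun ω => aucH0 μ X Z (X ω) (Z ω)) μ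
        / (variance (fun ω => aucH1 μ Z (X ω)) μ + variance (fun ω => aucH2 μ X (Z ω)) μ)
      = (1 - ε) / (2 * ε) ∧
    Tendsto (fun e : ℝ => (1 - e) / (2 * e)) (nhdsWithin 0 (Set.Ioi 0)) atTop := by
  obtain ⟨h0, h1⟩ := hε
  let A : Ω → ℝ := fun ω => 1 - X ω / 2
  let B : Ω → ℝ := fun ω => (1 + Z ω) / 2
  have hA : Measurable A := by fun_prop
  have hB : Measurable B := by fun_prop
  have hA01 : ∀ ω, A ω = 0 ∨ A ω = 1 := fun ω => by
    rcases hXval ω with h | h <;> norm_num [A, h]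
  have hB01 : ∀ ω, B ω = 0 ∨ B ω = 1 := fun ω => by
    rcases hZval ω with h | h <;> norm_num [B, h]
  have hAB : IndepFun A B μ :=
    hXZ.comp (φ := fun x : ℝ => 1 - x / 2) (ψ := fun z : ℝ => (1 + z) / 2)
      (by fun_prop) (by fun_prop)
  have hBε : ∫ ω, B ω ∂μ = ε := by
    have hs : MeasurableSet {ω | Z ω = 1} := hZmeas (measurableSet_singleton 1)
    have hB' : B = {ω | Z ω = 1}.indicator 1 := by
      ext ω
      rcases hZval ω with h | h <;> norm_num [B, h, Set.indicator]
    rw [hB', integral_indicator_one hs, measureReal_def, hZ1, ENNReal.toReal_ofReal h0.le]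
  have hAε : ∫ ω, A ω ∂μ = ε := by
    have hs : MeasurableSet {ω | X ω = 2} := hXmeas (measurableSet_singleton 2)
    have hA' : A = {ω | X ω = 2}ᶜ.indicator 1 := by
      ext ω
      rcases hXval ω with h | h <;> norm_num [A, h, Set.indicator]
    rw [hA', integral_indicator_one hs.compl, probReal_compl_eq_one_sub hs, measureReal_def, hX2,
      ENNReal.toReal_ofReal (by linarith)]
    ring
  have hH : ∀ ω ω', aucH (X ω) (Z ω') = 1 - A ω * B ω' := fun ω ω' => by
    rcases hXval ω with h | h <;> rcases hZval ω' with h' | h' <;> norm_num [aucH, A, B, h, h']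
  have hInt := integral_multilinear_of_indepFun hA hB hA01 hB01 hAB
  rw [hAε, hBε] at hInt
  have hU : aucU μ X Z = 1 - ε ^ 2 := by
    have e : ∀ ω, aucH (X ω) (Z ω) = 1 + 0 * A ω + 0 * B ω + (-1) * (A ω * B ω) := fun ω => by
      rw [hH]; ring
    simp_rw [aucU, e, hInt]
    ring
  have hH1 : ∀ ω, aucH1 μ Z (X ω) = 1 + (-ε) * A ω + 0 * B ω + 0 * (A ω * B ω) := fun ω => by
    have e : ∀ ω', aucH (X ω) (Z ω') = 1 + 0 * A ω' + (-A ω) * B ω' + 0 * (A ω' * B ω') :=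
      fun ω' => by rw [hH]; ring
    simp_rw [aucH1, e, hInt]
    ring
  have hH2 : ∀ ω, aucH2 μ X (Z ω) = 1 + 0 * A ω + (-ε) * B ω + 0 * (A ω * B ω) := fun ω => by
    have e : ∀ ω', aucH (X ω') (Z ω) = 1 + (-B ω) * A ω' + 0 * B ω' + 0 * (A ω' * B ω') :=
      fun ω' => by rw [hH]; ring
    simp_rw [aucH2, e, hInt]
    ring
  have hH0 : ∀ ω, aucH0 μ X Z (X ω) (Z ω)
      = (-ε ^ 2) + ε * A ω + ε * B ω + (-1) * (A ω * B ω) := fun ω => by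
    rw [aucH0, hH, hH1, hH2, hU]; ring
  have hVar := variance_multilinear_of_indepFun hA hB hA01 hB01 hAB hAε hBε
  refine ⟨hU, ?_, ?_⟩
  · simp_rw [hH0, hH1, hH2, hVar]
    have h2 : 0 < 1 - ε := by linarith
    have h3 : 0 < ε ^ 3 * (1 - ε) := by positivity
    rw [div_eq_div_iff (ne_of_gt (by linarith)) (by positivity)]
    ring
  · have e : ∀ x : ℝ, x ∈ Set.Ioi (0 : ℝ) → (1 / 2) * x⁻¹ + (-1 / 2) = (1 - x) / (2 * x) := by
      intro x hx
      have : x ≠ 0 := (Set.mem_Ioi.1 hx).ne'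
      field_simp
      ring
    refine Tendsto.congr' (eventually_mem_nhdsWithin.mono e) ?_
    exact tendsto_atTop_add_const_right _ _
      (tendsto_inv_nhdsGT_zero.const_mul_atTop (by norm_num))

end
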